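/- Suppose ρ = 1, α > 0, and lim_n n^γ r_n = c for some constants c > 0 and γ ∈ (1/2, 1). Let Z be the almost sure limit of Z_n. Then lim_{n→∞} n^{2γ−1} · E[(Z_n − Z)²] = (1/N) · (c²/(2γ − 1)) · E[Z(1 − Z)], and consequently, for every i ∈ {1,…,N}, lim_{n→∞} n^{2γ−1} · E[(Z_n(i) − Z)²] = (1/N) · (c²/(2γ − 1)) · E[Z(1 − Z)] as well. -/

import Mathlib

open MeasureTheory Filter Real

noncomputable section

/-- The σ-field `F_n = σ(Z_k(i) : 1 ≤ i ≤ N, 0 ≤ k ≤ n)` generated by the walks up to time `n`. -/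
def walkFiltration {Ω : Type*} [MeasurableSpace Ω] {N : ℕ}
    (Z : ℕ → Fin N → Ω → ℝ) (n : ℕ) : MeasurableSpace Ω :=
  ⨆ k ∈ Finset.range (n + 1), ⨆ i : Fin N, MeasurableSpace.comap (Z k i) (borel ℝ)

/-- The empirical mean `Z_n = N⁻¹ Σ_{i=1}^N Z_n(i)`. -/
def walkMean {Ω : Type*} {N : ℕ} (Z : ℕ → Fin N → Ω → ℝ) (n : ℕ) (ω : Ω) : ℝ :=
  (∑ i : Fin N, Z n i ω) / N

lemma aux_slope (β : ℝ) : Tendsto (fun n : ℕ => (n:ℝ) ^ (β+1) * ((n:ℝ)^(-β) - ((n+1 : ℕ):ℝ)^(-β))) atTop (nhds β) := by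
  have h : HasDerivAt (fun x : ℝ => x ^ (-β)) (-β * 1 ^ (-β - 1)) 1 :=
    Real.hasDerivAt_rpow_const (Or.inl one_ne_zero)
  rw [hasDerivAt_iff_tendsto_slope] at h
  have h2 : Tendsto (fun n : ℕ => 1 + 1/(n:ℝ)) atTop (nhdsWithin 1 {1}ᶜ) := by
    rw [tendsto_nhdsWithin_iff]
    constructor
    · simpa using (tendsto_const_nhds (x := (1:ℝ))).add (tendsto_one_div_atTop_nhds_zero_nat (𝕜 := ℝ))
    · filter_upwards [eventually_gt_atTop 0] with n hn
      have : (n:ℝ) ≠ 0 := by positivity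
      simp [this]
  have h3 := (h.comp h2).neg
  simp only [one_rpow, mul_one, neg_neg] at h3
  refine h3.congr' ?_
  filter_upwards [eventually_gt_atTop 0] with n hn
  have hn' : (0:ℝ) < n := by positivity
  have e1 : ((n+1 : ℕ):ℝ)^(-β) = (n:ℝ)^(-β) * (1 + 1/(n:ℝ))^(-β) := by
    rw [← Real.mul_rpow hn'.le (by positivity)]
    congr 1; push_cast; field_simp
  have e2 : (n:ℝ)^(β+1) = n * ((n:ℝ)^(-β))⁻¹ := by
    rw [Real.rpow_neg hn'.le, inv_inv, Real.rpow_add hn', Real.rpow_one]; ring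
  have : (n:ℝ)^(-β) ≠ 0 := by positivity
  simp only [Function.comp, slope_def_field, e1, e2, one_rpow]
  field_simp
  ring

lemma aux_stolz (β L : ℝ) (hβ : 0 < β) (y : ℕ → ℝ) (hy : Tendsto y atTop (nhds 0))
    (hd : Tendsto (fun n : ℕ => (n:ℝ)^(β+1) * (y n - y (n+1))) atTop (nhds (L * β))) :
    Tendsto (fun n : ℕ => (n:ℝ)^β * y n) atTop (nhds L) := by
  have hw : Tendsto (fun n : ℕ => (n:ℝ)^(-β)) atTop (nhds 0) :=
    (tendsto_rpow_neg_atTop hβ).comp tendsto_natCast_atTop_atTop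
  have up : ∀ (K : ℝ) (z : ℕ → ℝ) (A : ℝ), Tendsto z atTop (nhds 0) →
      Tendsto (fun n : ℕ => (n:ℝ)^(β+1) * (z n - z (n+1))) atTop (nhds (A * β)) → A < K →
      ∀ᶠ n : ℕ in atTop, (n:ℝ)^β * z n ≤ K := by
    intro K z A hz hd hAK
    have h1 := ((aux_slope β).const_mul K).sub hd
    have h2 : ∀ᶠ n : ℕ in atTop, 0 < K * ((n:ℝ) ^ (β+1) * ((n:ℝ)^(-β) - ((n+1 : ℕ):ℝ)^(-β))) - (n:ℝ)^(β+1) * (z n - z (n+1)) :=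
      h1.eventually (lt_mem_nhds (by nlinarith))
    obtain ⟨n0, hn0⟩ := eventually_atTop.1 h2
    filter_upwards [eventually_ge_atTop (n0+1)] with n hn
    have hmono : Monotone (fun k : ℕ => z (n+k) - K * ((n+k : ℕ):ℝ)^(-β)) := by
      apply monotone_nat_of_le_succ
      intro k
      have h := hn0 (n+k) (by omega)
      have hp : (0:ℝ) < ((n+k:ℕ):ℝ) := by
        have : 0 < n + k := by omega
        exact_mod_cast this
      have hp' : (0:ℝ) < ((n+k:ℕ):ℝ)^(β+1) := by positivity
      have : 0 < ((n+k:ℕ):ℝ)^(β+1) * (K * (((n+k:ℕ):ℝ)^(-β) - ((n+k+1 : ℕ):ℝ)^(-β)) - (z (n+k) - z (n+k+1))) := by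
        linarith
      have := (pos_iff_pos_of_mul_pos this).1 hp'
      have e : n + (k+1) = n+k+1 := by ring
      rw [e]
      linarith
    have hl : Tendsto (fun k : ℕ => z (n+k) - K * ((n+k : ℕ):ℝ)^(-β)) atTop (nhds 0) := by
      have h := hz.sub (hw.const_mul K)
      simp only [mul_zero, sub_zero] at h
      have := h.comp (tendsto_add_atTop_nat n)
      refine this.congr fun k => ?_
      simp [add_comm]
    have h := hmono.ge_of_tendsto hl 0
    simp only [add_zero] at h
    have hp : (0:ℝ) < (n:ℝ) := by
      have : 0 < n := by omega
      exact_mod_cast this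
    rw [Real.rpow_neg hp.le] at h
    have hp' : (0:ℝ) < (n:ℝ)^β := by positivity
    have : (n:ℝ)^β * z n ≤ (n:ℝ)^β * (K * ((n:ℝ)^β)⁻¹) := by
      gcongr; linarith
    calc _ ≤ _ := this
      _ = K := by field_simp
  rw [tendsto_order]
  constructor
  · intro a ha
    have := up (-((a+L)/2)) (fun n => - y n) (-L) (by simpa using hy.neg)
      (by refine (hd.neg.congr ?_).trans (by simp); intro n; ring) (by linarith)
    filter_upwards [this] with n hn
    linarith
  · intro a ha
    filter_upwards [up ((a+L)/2) y L hy hd (by linarith)] with n hn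
    linarith

lemma aux_rec (c γ α : ℝ) (hα0 : 0 < α) (hc : 0 < c) (hγ0 : 0 < γ) (hγ1 : γ < 1) (r x : ℕ → ℝ)
    (hr0 : ∀ n, 0 ≤ r n)
    (hlim : Tendsto (fun n : ℕ => (n : ℝ) ^ γ * r n) atTop (nhds c))
    (hx0 : ∀ n, 0 ≤ x n)
    (hx : ∀ n, x (n+1) ≤ (1 - 2*α*r n) * x n + 2 * r n ^ 2) :
    ∃ C : ℝ, ∀ᶠ n : ℕ in atTop, x n ≤ C * (n:ℝ)^(-γ) := by
  have hw : Tendsto (fun n : ℕ => (n:ℝ)^(-γ)) atTop (nhds 0) :=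
    (tendsto_rpow_neg_atTop hγ0).comp tendsto_natCast_atTop_atTop
  have hw1 : Tendsto (fun n : ℕ => (n:ℝ)^(-(1-γ))) atTop (nhds 0) :=
    (tendsto_rpow_neg_atTop (by linarith)).comp tendsto_natCast_atTop_atTop
  have e1 := hlim.eventually (lt_mem_nhds (show c/2 < c by linarith))
  have e2 := hlim.eventually (gt_mem_nhds (show c < 2*c by linarith))
  have e3 := hw.eventually (gt_mem_nhds (show 0 < 1/(4*α*c) by positivity))
  have e4 := hw1.eventually (gt_mem_nhds (show 0 < α*c/2 by positivity))
  obtain ⟨n0, h0⟩ := eventually_atTop.1 (e1.and (e2.and (e3.and (e4.and (eventually_gt_atTop 0)))))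
  refine ⟨max (x n0 * (n0:ℝ)^γ) (16*c/α), ?_⟩
  set C := max (x n0 * (n0:ℝ)^γ) (16*c/α) with hC
  have hC1 : 16 * c ≤ C * α := by
    have : 16*c/α ≤ C := le_max_right _ _
    rwa [div_le_iff₀ hα0] at this
  have hCpos : 0 < C := lt_of_lt_of_le (by positivity) (le_max_right _ _)
  filter_upwards [eventually_ge_atTop n0] with n hn
  induction n, hn using Nat.le_induction with
  | base =>
    have hp : (0:ℝ) < n0 := by exact_mod_cast (h0 n0 le_rfl).2.2.2.2
    rw [Real.rpow_neg hp.le, ← div_eq_mul_inv, le_div_iff₀ (by positivity)]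
    exact le_max_left _ _
  | succ n hn ih =>
    obtain ⟨a1, a2, a3, a4, a5⟩ := h0 n hn
    have hp : (0:ℝ) < n := by exact_mod_cast a5
    set w := (n:ℝ)^(-γ) with hwdef
    have hwpos : 0 < w := by positivity
    have hwi : (n:ℝ)^γ = w⁻¹ := by rw [hwdef, Real.rpow_neg hp.le, inv_inv]
    rw [hwi] at a1 a2
    have b1 : c/2 * w < r n := by
      have := mul_lt_mul_of_pos_right a1 hwpos
      have e : w⁻¹ * r n * w = r n := by field_simp
      rwa [e] at this
    have b2 : r n < 2*c * w := by
      have := mul_lt_mul_of_pos_right a2 hwpos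
      have e : w⁻¹ * r n * w = r n := by field_simp
      rwa [e] at this
    have b3 : 4*α*c*w < 1 := by
      rw [lt_div_iff₀ (by positivity)] at a3; linarith
    have b4 : 1/(n:ℝ) ≤ α*c/2*w := by
      have : (n:ℝ)^(-(1-γ)) * w = 1/n := by
        rw [hwdef, ← Real.rpow_add hp]
        rw [show -(1-γ) + -γ = -1 by ring, Real.rpow_neg_one, one_div]
      rw [← this]; gcongr
    have b5 : w * (1 - 1/n) ≤ ((n+1:ℕ):ℝ)^(-γ) := by
      have e : ((n+1 : ℕ):ℝ)^(-γ) = w * (1 + 1/(n:ℝ))^(-γ) := by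
        rw [← Real.mul_rpow hp.le (by positivity)]
        congr 1; push_cast; field_simp
      rw [e]
      gcongr
      have : (1 + 1/(n:ℝ))^(-1:ℝ) ≤ (1 + 1/(n:ℝ))^(-γ) := by
        apply Real.rpow_le_rpow_of_exponent_le
        · have : 0 < 1/(n:ℝ) := by positivity
          linarith
        · linarith
      refine le_trans ?_ this
      have hi : 0 < 1/(n:ℝ) := by positivity
      rw [Real.rpow_neg_one, inv_eq_one_div, le_div_iff₀ (by positivity)]
      nlinarith
    have c1 : 0 ≤ 1 - 2*α*r n := by nlinarith
    calc x (n+1) ≤ (1 - 2*α*r n) * x n + 2 * r n ^ 2 := hx n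
      _ ≤ (1 - 2*α*r n) * (C*w) + 2 * (2*c*w)^2 := by
          gcongr
          exact hr0 n
      _ ≤ (1 - 2*α*(c/2*w)) * (C*w) + 2 * (2*c*w)^2 := by
          gcongr
      _ ≤ C * (w * (1 - 1/n)) := by
          have h1 : C * w * (1/n) ≤ C * w * (α*c/2*w) := by gcongr
          have h2 : 16 * c * (c * w^2) ≤ C * α * (c*w^2) := by gcongr
          nlinarith
      _ ≤ C * ((n+1:ℕ):ℝ)^(-γ) := by gcongr

def BM {Ω : Type*} (m : MeasurableSpace Ω) (f : Ω → ℝ) : Prop :=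
  Measurable[m] f ∧ ∃ C : ℝ, ∀ ω, |f ω| ≤ C

lemma BM.add {Ω : Type*} {m : MeasurableSpace Ω} {f g : Ω → ℝ} (hf : BM m f) (hg : BM m g) :
    BM m (fun ω => f ω + g ω) := by
  obtain ⟨h1, C, hC⟩ := hf
  obtain ⟨h2, D, hD⟩ := hg
  exact ⟨h1.add h2, C + D, fun ω => (abs_add_le _ _).trans (add_le_add (hC ω) (hD ω))⟩

lemma BM.const {Ω : Type*} {m : MeasurableSpace Ω} (c : ℝ) : BM m (fun _ : Ω => c) :=
  ⟨measurable_const, |c|, fun _ => le_rfl⟩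

lemma BM.mul {Ω : Type*} {m : MeasurableSpace Ω} {f g : Ω → ℝ} (hf : BM m f) (hg : BM m g) :
    BM m (fun ω => f ω * g ω) := by
  obtain ⟨h1, C, hC⟩ := hf
  obtain ⟨h2, D, hD⟩ := hg
  refine ⟨h1.mul h2, C * D, fun ω => ?_⟩
  rw [abs_mul]
  exact mul_le_mul (hC ω) (hD ω) (abs_nonneg _) ((abs_nonneg _).trans (hC ω))

lemma BM.cmul {Ω : Type*} {m : MeasurableSpace Ω} {f : Ω → ℝ} (c : ℝ) (hf : BM m f) :
    BM m (fun ω => c * f ω) := (BM.const c).mul hf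

lemma BM.sub {Ω : Type*} {m : MeasurableSpace Ω} {f g : Ω → ℝ} (hf : BM m f) (hg : BM m g) :
    BM m (fun ω => f ω - g ω) := by
  have := hf.add (hg.cmul (-1))
  simpa [sub_eq_add_neg] using this

lemma BM.sq {Ω : Type*} {m : MeasurableSpace Ω} {f : Ω → ℝ} (hf : BM m f) :
    BM m (fun ω => f ω ^ 2) := by
  have := hf.mul hf
  simpa [pow_two] using this

lemma BM.sum {Ω ι : Type*} {m : MeasurableSpace Ω} (s : Finset ι) {f : ι → Ω → ℝ}
    (hf : ∀ i, BM m (f i)) : BM m (fun ω => ∑ i ∈ s, f i ω) := by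
  classical
  induction s using Finset.induction_on with
  | empty => simpa using BM.const (m := m) 0
  | insert a s ha ih =>
    simp only [Finset.sum_insert ha]
    exact (hf a).add ih

lemma BM.mono {Ω : Type*} {m m' : MeasurableSpace Ω} (h : m ≤ m') {f : Ω → ℝ} (hf : BM m f) :
    BM m' f := ⟨hf.1.mono h le_rfl, hf.2⟩

lemma BM.int {Ω : Type*} {m : MeasurableSpace Ω} {μ : Measure Ω} [IsProbabilityMeasure μ]
    {f : Ω → ℝ} (hf : BM m f) : Integrable f μ := by
  obtain ⟨h1, C, hC⟩ := hf
  exact Integrable.of_bound h1.aestronglyMeasurable C (ae_of_all _ hC)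

lemma aux_pull {Ω : Type*} {m0 : MeasurableSpace Ω} (μ : Measure Ω) [IsProbabilityMeasure μ]
    (m : MeasurableSpace Ω) (hm : m ≤ m0) {X Y P : Ω → ℝ} (hX : BM m X) (hY : BM m0 Y)
    (h : μ[Y | m] =ᵐ[μ] P) : ∫ ω, X ω * Y ω ∂μ = ∫ ω, X ω * P ω ∂μ := by
  have h1 : μ[X * Y | m] =ᵐ[μ] X * μ[Y | m] :=
    condExp_mul_of_stronglyMeasurable_left hX.1.stronglyMeasurable ((hX.mono hm).mul hY).int hY.int
  calc ∫ ω, X ω * Y ω ∂μ = ∫ ω, (X * Y) ω ∂μ := rfl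
    _ = ∫ ω, (μ[X * Y | m]) ω ∂μ := (integral_condExp hm).symm
    _ = ∫ ω, X ω * P ω ∂μ := by
      apply integral_congr_ae
      filter_upwards [h1, h] with ω a b
      rw [a, Pi.mul_apply, b]

section
variable {Ω : Type*} [m0 : MeasurableSpace Ω] {N : ℕ} (Z : ℕ → Fin N → Ω → ℝ)

lemma wf_le (hZmeas : ∀ n i, Measurable (Z n i)) (n : ℕ) : walkFiltration Z n ≤ m0 := by
  unfold walkFiltration
  refine iSup₂_le fun k _ => iSup_le fun i => ?_
  have := (hZmeas k i).comap_le
  rwa [BorelSpace.measurable_eq (α := ℝ)] at this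

lemma wf_mono {n k : ℕ} (h : n ≤ k) : walkFiltration Z n ≤ walkFiltration Z k := by
  unfold walkFiltration
  refine iSup₂_le fun j hj => ?_
  refine le_iSup₂_of_le j ?_ le_rfl
  simp only [Finset.mem_range] at *; omega

lemma wf_bm (hZ01 : ∀ n i ω, Z n i ω ∈ Set.Icc (0:ℝ) 1) (n : ℕ) (i : Fin N) :
    BM (walkFiltration Z n) (Z n i) := by
  constructor
  · rw [measurable_iff_comap_le, BorelSpace.measurable_eq (α := ℝ)]
    unfold walkFiltration
    refine le_iSup₂_of_le n (by simp) ?_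
    exact le_iSup (fun i => MeasurableSpace.comap (Z n i) (borel ℝ)) i
  · exact ⟨1, fun ω => by rw [abs_of_nonneg (hZ01 n i ω).1]; exact (hZ01 n i ω).2⟩

lemma wm_bm (hZ01 : ∀ n i ω, Z n i ω ∈ Set.Icc (0:ℝ) 1) (n : ℕ) :
    BM (walkFiltration Z n) (walkMean Z n) := by
  have := (BM.sum Finset.univ (wf_bm Z hZ01 n)).mul (BM.const (1/(N:ℝ)))
  have e : walkMean Z n = fun ω => (∑ i, Z n i ω) * (1/(N:ℝ)) := by
    funext ω; unfold walkMean; ring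
  rw [e]; exact this

lemma wm01 (hN : 1 ≤ N) (hZ01 : ∀ n i ω, Z n i ω ∈ Set.Icc (0:ℝ) 1) (n : ℕ) (ω : Ω) :
    walkMean Z n ω ∈ Set.Icc (0:ℝ) 1 := by
  have hp : (0:ℝ) < N := by exact_mod_cast hN
  unfold walkMean
  constructor
  · exact div_nonneg (Finset.sum_nonneg fun i _ => (hZ01 n i ω).1) hp.le
  · rw [div_le_one hp]
    calc _ ≤ ∑ i : Fin N, (1:ℝ) := Finset.sum_le_sum fun i _ => (hZ01 n i ω).2
      _ = N := by simp
end

lemma lin3 {Ω : Type*} {m0 : MeasurableSpace Ω} (μ : Measure Ω) [IsProbabilityMeasure μ]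
    {f g h : Ω → ℝ} (hf : BM m0 f) (hg : BM m0 g) (hh : BM m0 h) (a b c : ℝ) :
    ∫ ω, (a * f ω + b * g ω + c * h ω) ∂μ = a * ∫ ω, f ω ∂μ + b * ∫ ω, g ω ∂μ + c * ∫ ω, h ω ∂μ := by
  rw [integral_add ((hf.cmul a).add (hg.cmul b)).int (hh.cmul c).int,
    integral_add (hf.cmul a).int (hg.cmul b).int, integral_const_mul, integral_const_mul,
    integral_const_mul]

lemma aux_step {Ω : Type*} {m0 : MeasurableSpace Ω} (μ : Measure Ω) [IsProbabilityMeasure μ]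
    (m : MeasurableSpace Ω) (hm : m ≤ m0) (N : ℕ) (hN : 1 ≤ N) (α r : ℝ)
    (z I z' : Fin N → Ω → ℝ) (M M' : Ω → ℝ) (hz : ∀ i, BM m (z i))
    (hI : ∀ i, BM m0 (I i)) (hI01 : ∀ i ω, I i ω = 0 ∨ I i ω = 1)
    (hM : ∀ ω, M ω = (∑ i, z i ω) / N) (hM' : ∀ ω, M' ω = (∑ i, z' i ω) / N)
    (hMB : BM m M)
    (hdyn : ∀ i ω, z' i ω = (1 - r) * z i ω + r * I i ω)
    (hcond : ∀ (s : Finset (Fin N)), μ[(fun ω => ∏ i ∈ s, I i ω) | m]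
        =ᵐ[μ] fun ω => ∏ i ∈ s, ((1 - α) * z i ω + α * M ω)) :
    (∀ X, BM m X → ∫ ω, X ω * M' ω ∂μ = ∫ ω, X ω * M ω ∂μ) ∧
    (∫ ω, M' ω ^ 2 ∂μ = ∫ ω, M ω ^ 2 ∂μ + r ^ 2 / N * (∫ ω, M ω * (1 - M ω) ∂μ
      - (1 - α)^2 * (1/N) * ∑ i, ∫ ω, (z i ω - M ω)^2 ∂μ)) ∧
    (0 ≤ r → r ≤ 1 → α ∈ Set.Icc (0:ℝ) 1 → (∀ i ω, (z i ω - M ω)^2 ≤ 1) → ∀ i,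
      ∫ ω, (z' i ω - M' ω)^2 ∂μ ≤ (1 - 2*α*r) * ∫ ω, (z i ω - M ω)^2 ∂μ + 2 * r^2) := by
  have hp : (0:ℝ) < N := by exact_mod_cast hN
  set p : Fin N → Ω → ℝ := fun i ω => (1 - α) * z i ω + α * M ω with hpdef
  have hpB : ∀ i, BM m (p i) := fun i => ((hz i).cmul _).add (hMB.cmul _)
  set J : Ω → ℝ := fun ω => (1/(N:ℝ)) * (∑ i, I i ω) with hJdef
  have hJB : BM m0 J := (BM.sum Finset.univ hI).cmul _
  have hJM : ∀ ω, M' ω = (1 - r) * M ω + r * J ω := by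
    intro ω
    simp only [hM', hM, hJdef, hdyn, Finset.sum_add_distrib, ← Finset.mul_sum]
    ring
  have hsz : ∀ ω, ∑ i, z i ω = N * M ω := by
    intro ω; rw [hM]; field_simp
  have hsp : ∀ ω, ∑ i, p i ω = N * M ω := by
    intro ω
    simp only [hpdef, Finset.sum_add_distrib, ← Finset.mul_sum, hsz]
    simp; ring
  have h1 : ∀ X i, BM m X → ∫ ω, X ω * I i ω ∂μ = ∫ ω, X ω * p i ω ∂μ := by
    intro X i hX
    apply aux_pull μ m hm hX (hI i)
    simpa using hcond {i}
  have hJ : ∀ X, BM m X → ∫ ω, X ω * J ω ∂μ = ∫ ω, X ω * M ω ∂μ := by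
    intro X hX
    have e1 : ∀ ω, X ω * J ω = (1/(N:ℝ)) * ∑ i, X ω * I i ω := by
      intro ω; rw [← Finset.mul_sum]; simp only [hJdef]; ring
    have e2 : ∀ ω, X ω * M ω = (1/(N:ℝ)) * ∑ i, X ω * p i ω := by
      intro ω; rw [← Finset.mul_sum, hsp]; field_simp
    simp only [e1, e2]
    rw [integral_const_mul, integral_const_mul,
      integral_finsetSum _ (fun i _ => ((hX.mono hm).mul (hI i)).int),
      integral_finsetSum _ (fun i _ => ((hX.mono hm).mul ((hpB i).mono hm)).int)]
    simp only [h1 X _ hX]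
  have hMB0 := hMB.mono hm
  have hzB0 := fun i => (hz i).mono hm
  have hpB0 := fun i => (hpB i).mono hm
  have hJJ : ∫ ω, J ω ^ 2 ∂μ = ∫ ω, M ω ^ 2 ∂μ + 1 / N * (∫ ω, M ω * (1 - M ω) ∂μ
      - (1 - α)^2 * (1/N) * ∑ i, ∫ ω, (z i ω - M ω)^2 ∂μ) := by
    have h2 : ∀ i j, ∫ ω, I i ω * I j ω ∂μ = ∫ ω, p i ω * p j ω ∂μ +
        if i = j then ∫ ω, (p i ω - p i ω ^ 2) ∂μ else 0 := by
      intro i j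
      by_cases hij : i = j
      · subst hij
        have e : ∀ ω, I i ω * I i ω = 1 * I i ω := by
          intro ω; rcases hI01 i ω with h | h <;> simp [h]
        simp only [e, if_true]
        rw [h1 (fun _ => 1) i (BM.const 1), ← integral_add ((hpB0 i).mul (hpB0 i)).int
          ((hpB0 i).sub (hpB0 i).sq).int]
        congr 1; funext ω; ring
      · have := aux_pull μ m hm (X := fun _ => 1) (BM.const 1) ((hI i).mul (hI j))
          (P := fun ω => p i ω * p j ω) (by
            have := hcond {i, j}
            simpa [Finset.prod_pair hij] using this)
        simpa [hij] using this
    have e1 : ∀ ω, J ω ^ 2 = (1/(N:ℝ))^2 * ∑ i, ∑ j, I i ω * I j ω := by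
      intro ω; rw [← Finset.sum_mul_sum]; simp only [hJdef]; ring
    have e2 : ∀ ω, M ω ^ 2 = (1/(N:ℝ))^2 * ∑ i, ∑ j, p i ω * p j ω := by
      intro ω; rw [← Finset.sum_mul_sum, hsp]; field_simp
    have e3 : ∫ ω, J ω ^ 2 ∂μ = (1/(N:ℝ))^2 * ∑ i, ∑ j, ∫ ω, I i ω * I j ω ∂μ := by
      simp only [e1]
      rw [integral_const_mul, integral_finsetSum _
        (fun i _ => (BM.sum Finset.univ (fun j => (hI i).mul (hI j))).int)]
      congr 1
      refine Finset.sum_congr rfl fun i _ => ?_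
      exact integral_finsetSum _ (fun j _ => ((hI i).mul (hI j)).int)
    have e4 : ∫ ω, M ω ^ 2 ∂μ = (1/(N:ℝ))^2 * ∑ i, ∑ j, ∫ ω, p i ω * p j ω ∂μ := by
      simp only [e2]
      rw [integral_const_mul, integral_finsetSum _
        (fun i _ => (BM.sum Finset.univ (fun j => (hpB0 i).mul (hpB0 j))).int)]
      congr 1
      refine Finset.sum_congr rfl fun i _ => ?_
      exact integral_finsetSum _ (fun j _ => ((hpB0 i).mul (hpB0 j)).int)
    have e5 : ∑ i, ∫ ω, (p i ω - p i ω ^ 2) ∂μ = N * ∫ ω, M ω * (1 - M ω) ∂μ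
      - (1 - α)^2 * ∑ i, ∫ ω, (z i ω - M ω)^2 ∂μ := by
      rw [← integral_finsetSum _ (fun i _ => ((hpB0 i).sub (hpB0 i).sq).int),
        ← integral_finsetSum _ (fun i _ => ((hzB0 i).sub hMB0).sq.int),
        ← integral_const_mul, ← integral_const_mul,
        ← integral_sub ((hMB0.mul ((BM.const 1).sub hMB0)).cmul _).int
          ((BM.sum Finset.univ (fun i => ((hzB0 i).sub hMB0).sq)).cmul _).int]
      congr 1; funext ω
      have q1 : ∀ i, p i ω - p i ω ^ 2 = p i ω - (2 * (1-α) * M ω * (z i ω - M ω) + M ω ^ 2)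
          - (1-α)^2 * (z i ω - M ω)^2 := by
        intro i; simp only [hpdef]; ring
      simp only [q1, Finset.sum_sub_distrib, Finset.sum_add_distrib, hsp, ← Finset.mul_sum, hsz]
      simp
      ring
    rw [e3]
    simp only [h2, Finset.sum_add_distrib, mul_add]
    rw [← e4]
    simp only [Finset.sum_ite_eq, Finset.mem_univ, if_true]
    rw [e5]
    field_simp
  refine ⟨?_, ?_, ?_⟩
  · intro X hX
    have := lin3 μ ((hX.mono hm).mul hMB0) ((hX.mono hm).mul hJB) (BM.const 0) (1-r) r 0
    rw [hJ X hX] at this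
    calc _ = _ := by
          congr 1; funext ω; rw [hJM ω]
          show _ = (1-r) * (X ω * M ω) + r * (X ω * J ω) + 0 * 0
          ring
      _ = _ := this
      _ = _ := by ring
  · have := lin3 μ hMB0.sq (hMB0.mul hJB) hJB.sq ((1-r)^2) (2*r*(1-r)) (r^2)
    rw [hJ M hMB, hJJ] at this
    have e : ∫ ω, M ω * M ω ∂μ = ∫ ω, M ω ^ 2 ∂μ := by simp only [pow_two]
    rw [e] at this
    calc _ = _ := by
          congr 1; funext ω; rw [hJM ω]
          show _ = (1-r)^2 * (M ω ^ 2) + 2*r*(1-r) * (M ω * J ω) + r^2 * J ω ^ 2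
          ring
      _ = _ := this
      _ = _ := by ring
  · intro hr0 hr1 hα hle i
    have hD := (hz i).sub hMB
    have hD0 := hD.mono hm
    have := lin3 μ hD0.sq (hD0.mul ((hI i).sub hJB)) ((hI i).sub hJB).sq ((1-r)^2) (2*r*(1-r)) (r^2)
    have e1 : ∫ ω, (z i ω - M ω) * (I i ω - J ω) ∂μ = (1-α) * ∫ ω, (z i ω - M ω)^2 ∂μ := by
      simp only [mul_sub (_ - _) (I i _)]
      rw [integral_sub (hD0.mul (hI i)).int (hD0.mul hJB).int, h1 _ i hD, hJ _ hD,
        ← integral_sub (hD0.mul (hpB0 i)).int (hD0.mul hMB0).int, ← integral_const_mul]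
      congr 1; funext ω; simp only [hpdef]; ring
    have bound : ∀ f : Ω → ℝ, BM m0 f → (∀ ω, f ω ≤ 1) → ∫ ω, f ω ∂μ ≤ 1 := by
      intro f hf h
      calc _ ≤ ∫ ω, (1:ℝ) ∂μ := integral_mono hf.int (BM.const (m := m0) 1).int h
        _ = 1 := by simp
    have e2 : ∫ ω, (I i ω - J ω)^2 ∂μ ≤ 1 := by
      apply bound _ ((hI i).sub hJB).sq
      intro ω
      have i01 : ∀ j, 0 ≤ I j ω ∧ I j ω ≤ 1 := by
        intro j; rcases hI01 j ω with h | h <;> simp [h]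
      have j0 : 0 ≤ J ω := mul_nonneg (by positivity) (Finset.sum_nonneg fun j _ => (i01 j).1)
      have j1 : J ω ≤ 1 := by
        simp only [hJdef]
        rw [one_div, inv_mul_le_iff₀ hp]
        calc _ ≤ ∑ i : Fin N, (1:ℝ) := Finset.sum_le_sum fun j _ => (i01 j).2
          _ = _ := by simp
      have := i01 i
      show (I i ω - J ω)^2 ≤ 1
      rw [sq_le_one_iff_abs_le_one, abs_le]
      constructor <;> linarith
    have e3 : ∫ ω, (z i ω - M ω)^2 ∂μ ≤ 1 := bound _ hD0.sq (hle i)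
    have e4 : 0 ≤ ∫ ω, (z i ω - M ω)^2 ∂μ := integral_nonneg fun ω => sq_nonneg _
    rw [e1] at this
    calc _ = _ := by
          congr 1; funext ω; rw [hJM ω, hdyn]
          show _ = (1-r)^2 * ((z i ω - M ω) ^ 2) + 2*r*(1-r) * ((z i ω - M ω) * (I i ω - J ω))
            + r^2 * (I i ω - J ω) ^ 2
          ring
      _ = _ := this
      _ ≤ _ := by
        set x := ∫ ω, (z i ω - M ω)^2 ∂μ
        have a1 : r^2 * ∫ ω, (I i ω - J ω)^2 ∂μ ≤ r^2 * 1 := by gcongr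
        have a2 : r^2 * ((2*α-1)*x) ≤ r^2 * 1 := by
          gcongr
          nlinarith [hα.1, hα.2]
        nlinarith

/-- **Rate of convergence in L²**: for `ρ = 1`, `α > 0` and `n^γ r_n → c > 0` with
`1/2 < γ < 1`, `n^{2γ-1} E[(Z_n - Z)²] → (1/N)(c²/(2γ-1)) E[Z(1-Z)]`, and the same
limit holds for `n^{2γ-1} E[(Z_n(i) - Z)²]` for every `i`. -/
theorem stmt_12
    {Ω : Type*} [MeasurableSpace Ω] (μ : Measure Ω) [IsProbabilityMeasure μ]
    (N : ℕ) (hN : 1 ≤ N)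
    (ρ α q : ℝ)
    (hρ : ρ ∈ Set.Icc (0:ℝ) 1) (hα : α ∈ Set.Icc (0:ℝ) 1) (hq : q ∈ Set.Icc (0:ℝ) 1)
    (r : ℕ → ℝ) (hr : ∀ n, 0 ≤ r n ∧ r n < 1)
    (Z : ℕ → Fin N → Ω → ℝ) (I : ℕ → Fin N → Ω → ℝ)
    (hZmeas : ∀ n i, Measurable (Z n i))
    (hImeas : ∀ n i, Measurable (I n i))
    (hZ01 : ∀ n i ω, Z n i ω ∈ Set.Icc (0:ℝ) 1)
    (hI01 : ∀ n i ω, I n i ω = 0 ∨ I n i ω = 1)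
    -- dynamics: `Z_{n+1}(i) = (1 - r_n) Z_n(i) + r_n (ρ I_{n+1}(i) + (1-ρ) q)`
    -- (here `I n i` stands for `I_{n+1}(i)`)
    (hdyn : ∀ n i ω, Z (n + 1) i ω
      = (1 - r n) * Z n i ω + r n * (ρ * I n i ω + (1 - ρ) * q))
    -- conditional independence of `I_{n+1}(1), …, I_{n+1}(N)` given `F_n`, together with
    -- the conditional law `P(I_{n+1}(i) = 1 | F_n) = (1-α) Z_n(i) + α Z_n`, expressed
    -- (equivalently, for {0,1}-valued variables) through conditional product moments
    (hcond : ∀ n (s : Finset (Fin N)),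
      μ[(fun ω => ∏ i ∈ s, I n i ω) | walkFiltration Z n]
        =ᵐ[μ] fun ω => ∏ i ∈ s, ((1 - α) * Z n i ω + α * walkMean Z n ω))
    -- the initial configuration is permutation invariant with mean 1/2 and E[Z_0(1-Z_0)] > 0
    (hperm : ∀ σ : Equiv.Perm (Fin N),
      μ.map (fun ω (i : Fin N) => Z 0 (σ i) ω) = μ.map (fun ω (i : Fin N) => Z 0 i ω))
    (hmean0 : ∀ i, ∫ ω, Z 0 i ω ∂μ = 1 / 2)
    (hvar0 : 0 < ∫ ω, walkMean Z 0 ω * (1 - walkMean Z 0 ω) ∂μ)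
    (hρ1 : ρ = 1) (hα0 : 0 < α)
    (c γ : ℝ) (hc : 0 < c) (hγ : 1/2 < γ ∧ γ < 1)
    (hlim : Tendsto (fun n : ℕ => (n : ℝ) ^ γ * r n) atTop (nhds c))
    (Zlim : Ω → ℝ) (hZlimMeas : Measurable Zlim)
    (hZlim : ∀ᵐ ω ∂μ, Tendsto (fun n => walkMean Z n ω) atTop (nhds (Zlim ω))) :
    Tendsto
      (fun n : ℕ => (n : ℝ) ^ (2 * γ - 1) * ∫ ω, (walkMean Z n ω - Zlim ω) ^ 2 ∂μ)
      atTop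
      (nhds ((1 / N) * (c ^ 2 / (2 * γ - 1)) * ∫ ω, Zlim ω * (1 - Zlim ω) ∂μ))
    ∧ ∀ i : Fin N, Tendsto
      (fun n : ℕ => (n : ℝ) ^ (2 * γ - 1) * ∫ ω, (Z n i ω - Zlim ω) ^ 2 ∂μ)
      atTop
      (nhds ((1 / N) * (c ^ 2 / (2 * γ - 1)) * ∫ ω, Zlim ω * (1 - Zlim ω) ∂μ)) := by
  subst hρ1
  have hp : (0:ℝ) < N := by exact_mod_cast hN
  have hdyn' : ∀ n i ω, Z (n + 1) i ω = (1 - r n) * Z n i ω + r n * I n i ω := by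
    intro n i ω; rw [hdyn]; ring
  have hzB := wf_bm Z hZ01
  have hMB := wm_bm Z hZ01
  have hm := wf_le Z hZmeas
  have hM01 := wm01 Z hN hZ01
  have hIB : ∀ n i, BM _ (I n i) := fun n i =>
    ⟨hImeas n i, 1, fun ω => by rcases hI01 n i ω with h | h <;> simp [h]⟩
  have step := fun n => aux_step μ (walkFiltration Z n) (hm n) N hN α (r n) (Z n) (I n) (Z (n+1))
    (walkMean Z n) (walkMean Z (n+1)) (hzB n) (hIB n) (hI01 n) (fun _ => rfl) (fun _ => rfl)
    (hMB n) (hdyn' n) (hcond n)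
  set M := walkMean Z with hMdef
  set e : ℕ → ℝ := fun n => ∫ ω, M n ω ^ 2 ∂μ with he
  set x : Fin N → ℕ → ℝ := fun i n => ∫ ω, (Z n i ω - M n ω)^2 ∂μ with hx
  have hMB0 := fun n => (hMB n).mono (hm n)
  have hzB0 := fun n i => (hzB n i).mono (hm n)
  -- martingale property
  have mart : ∀ n k, n ≤ k → ∀ X, BM (walkFiltration Z n) X →
      ∫ ω, X ω * M k ω ∂μ = ∫ ω, X ω * M n ω ∂μ := by
    intro n k hk X hX
    induction k, hk using Nat.le_induction with
    | base => rfl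
    | succ k hk ih => rw [(step k).1 X (hX.mono (wf_mono Z hk)), ih]
  have dct : ∀ (φ : ℝ → Ω → ℝ) (C : ℝ), (∀ n, BM inferInstance (fun ω => φ (M n ω) ω)) →
      (∀ n ω, |φ (M n ω) ω| ≤ C) → (∀ ω, Continuous (fun t => φ t ω)) →
      Tendsto (fun n => ∫ ω, φ (M n ω) ω ∂μ) atTop (nhds (∫ ω, φ (Zlim ω) ω ∂μ)) := by
    intro φ C h1 h2 h3
    refine tendsto_integral_of_dominated_convergence (fun _ => C)
      (fun n => (h1 n).1.aestronglyMeasurable) (integrable_const _)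
      (fun n => ae_of_all _ (h2 n)) ?_
    filter_upwards [hZlim] with ω hω
    exact ((h3 ω).tendsto _).comp hω
  set E := ∫ ω, Zlim ω ^ 2 ∂μ with hE
  set V := ∫ ω, Zlim ω * (1 - Zlim ω) ∂μ with hV
  have heE : Tendsto e atTop (nhds E) := by
    refine dct (fun t _ => t^2) 1 (fun n => (hMB0 n).sq) ?_ (fun ω => by fun_prop)
    intro n ω
    have := hM01 n ω
    rw [abs_of_nonneg (sq_nonneg _), sq_le_one_iff_abs_le_one, abs_le]
    exact ⟨by linarith [this.1], this.2⟩
  have hvV : Tendsto (fun n => ∫ ω, M n ω * (1 - M n ω) ∂μ) atTop (nhds V) := by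
    refine dct (fun t _ => t*(1-t)) 1 (fun n => (hMB0 n).mul ((BM.const 1).sub (hMB0 n))) ?_
      (fun ω => by fun_prop)
    intro n ω
    have := hM01 n ω
    rw [abs_le]
    constructor <;> nlinarith [this.1, this.2]
  have decomp : ∀ n W, BM (walkFiltration Z n) W → (∀ ω, W ω ∈ Set.Icc (0:ℝ) 1) →
      ∫ ω, (W ω - Zlim ω)^2 ∂μ = ∫ ω, (W ω - M n ω)^2 ∂μ + (E - e n) := by
    intro n W hW hW01
    have hW0 := hW.mono (hm n)
    have t1 : Tendsto (fun k => ∫ ω, (W ω - M k ω)^2 ∂μ) atTop (nhds (∫ ω, (W ω - Zlim ω)^2 ∂μ)) := by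
      refine dct (fun t ω => (W ω - t)^2) 1 (fun n => (hW0.sub (hMB0 n)).sq) ?_ (fun ω => by fun_prop)
      intro k ω
      have := hM01 k ω
      have h2 := hW01 ω
      rw [abs_of_nonneg (sq_nonneg _), sq_le_one_iff_abs_le_one, abs_le]
      exact ⟨by linarith [this.2, h2.1], by linarith [this.1, h2.2]⟩
    have t2 : Tendsto (fun k => ∫ ω, (W ω - M n ω)^2 ∂μ + (e k - e n)) atTop
        (nhds (∫ ω, (W ω - M n ω)^2 ∂μ + (E - e n))) :=
      tendsto_const_nhds.add (heE.sub tendsto_const_nhds)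
    refine tendsto_nhds_unique t1 (t2.congr' ?_)
    filter_upwards [eventually_ge_atTop n] with k hk
    have ex : ∀ k, ∫ ω, (W ω - M k ω)^2 ∂μ = ∫ ω, W ω ^ 2 ∂μ - 2 * ∫ ω, W ω * M k ω ∂μ + e k := by
      intro k
      have := lin3 μ hW0.sq (hW0.mul (hMB0 k)) (hMB0 k).sq 1 (-2) 1
      calc _ = _ := by
            congr 1; funext ω
            show _ = 1 * W ω ^ 2 + (-2) * (W ω * M k ω) + 1 * M k ω ^ 2
            ring
        _ = _ := this
        _ = _ := by simp only [he]; ring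
    rw [ex n, ex k, mart n k hk W hW]
    ring
  have hDle : ∀ n i ω, (Z n i ω - M n ω)^2 ≤ 1 := by
    intro n i ω
    have := hM01 n ω
    have h2 := hZ01 n i ω
    rw [sq_le_one_iff_abs_le_one, abs_le]
    exact ⟨by linarith [this.2, h2.1], by linarith [this.1, h2.2]⟩
  have hxrec : ∀ i n, x i (n+1) ≤ (1 - 2*α*r n) * x i n + 2 * r n ^ 2 := fun i n =>
    (step n).2.2 (hr n).1 (hr n).2.le hα (hDle n) i
  have hx0 : ∀ i n, 0 ≤ x i n := fun i n => integral_nonneg fun ω => sq_nonneg _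
  have hxβ : ∀ i, ∀ β, β < γ → Tendsto (fun n : ℕ => (n:ℝ)^β * x i n) atTop (nhds 0) := by
    intro i β hβ
    obtain ⟨C, hC⟩ := aux_rec c γ α hα0 hc (by linarith) hγ.2 r (x i) (fun n => (hr n).1) hlim
      (hx0 i) (hxrec i)
    have hw : Tendsto (fun n : ℕ => C * (n:ℝ)^(-(γ-β))) atTop (nhds 0) := by
      simpa using ((tendsto_rpow_neg_atTop (show 0 < γ - β by linarith)).comp
        tendsto_natCast_atTop_atTop).const_mul C
    refine squeeze_zero' (Eventually.of_forall fun n => mul_nonneg (by positivity) (hx0 i n)) ?_ hw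
    filter_upwards [hC, eventually_gt_atTop 0] with n hn hn0
    have hp : (0:ℝ) < n := by exact_mod_cast hn0
    calc (n:ℝ)^β * x i n ≤ (n:ℝ)^β * (C * (n:ℝ)^(-γ)) := by gcongr
      _ = C * ((n:ℝ)^β * (n:ℝ)^(-γ)) := by ring
      _ = _ := by rw [← Real.rpow_add hp]; congr 2; ring
  have hx1 : ∀ i, Tendsto (x i) atTop (nhds 0) := by
    intro i
    simpa using hxβ i 0 (by linarith)
  have hmain : Tendsto (fun n : ℕ => (n:ℝ)^(2*γ-1) * (E - e n)) atTop
      (nhds ((1 / N) * (c ^ 2 / (2 * γ - 1)) * V)) := by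
    apply aux_stolz (2*γ-1) _ (by linarith)
    · simpa using (tendsto_const_nhds (x := E)).sub heE
    · have hs : Tendsto (fun n => ∑ i, x i n) atTop (nhds 0) := by
        simpa using tendsto_finsetSum Finset.univ (fun i _ => hx1 i)
      have h1 := (((hlim.mul hlim).mul_const (1/(N:ℝ))).mul
        (hvV.sub (hs.const_mul ((1 - α)^2 * (1/N)))))
      have hb : 2*γ-1 ≠ 0 := by linarith
      have e0 : c * c * (1/(N:ℝ)) * (V - (1 - α)^2 * (1/N) * 0)
        = (1 / N) * (c ^ 2 / (2 * γ - 1)) * V * (2*γ-1) := by field_simp; ring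
      rw [e0] at h1
      refine h1.congr' ?_
      filter_upwards [eventually_gt_atTop 0] with n hn0
      have hp : (0:ℝ) < n := by exact_mod_cast hn0
      have e1 : (n:ℝ)^(2*γ-1+1) = (n:ℝ)^γ * (n:ℝ)^γ := by
        rw [← Real.rpow_add hp]; congr 1; ring
      have e2 : e (n+1) = e n + r n ^ 2 / N * (∫ ω, M n ω * (1 - M n ω) ∂μ
        - (1 - α)^2 * (1/N) * ∑ i, x i n) := (step n).2.1
      rw [e1, e2]
      ring
  constructor
  · refine hmain.congr fun n => ?_
    rw [decomp n (M n) (hMB n) (hM01 n)]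
    simp
  · intro i
    have := (hxβ i (2*γ-1) (by linarith)).add hmain
    rw [zero_add] at this
    refine this.congr fun n => ?_
    rw [decomp n (Z n i) (hzB n i) (hZ01 n i)]
    simp only [hx]
    ring
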